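/- Let n and d be integers with 2 ≤ d ≤ n−1, and let T be a tree on n vertices with diameter d. Then H(T) ≤ H(C_{n,d,⌊d/2⌋}), with equality if and only if T is isomorphic to C_{n,d,⌊d/2⌋}. -/

import Mathlib

open Finset SimpleGraph

open Classical in
/-- The Harary index: half the sum, over ordered pairs of distinct vertices, of the
reciprocal of the shortest-path distance (so each unordered pair is counted once). -/
noncomputable def harary {V : Type*} [Fintype V] (G : SimpleGraph V) : ℝ :=
  (∑ u : V, ∑ v : V, if u = v then 0 else (1 : ℝ) / (G.dist u v)) / 2

/-- The path graph `P_n` on `n` vertices. -/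
def pathG (n : ℕ) : SimpleGraph (Fin n) :=
  SimpleGraph.fromRel (fun x y => (y : ℕ) = (x : ℕ) + 1)

/-- The star graph `S_n` on `n` vertices, with center `0`. -/
def starG (n : ℕ) : SimpleGraph (Fin n) :=
  SimpleGraph.fromRel (fun x y => (x : ℕ) = 0 ∧ (y : ℕ) ≠ 0)

/-- The spider (starlike tree) `S(L 0, …, L (k-1))`: a center `none` together with `k`
disjoint paths, the `i`-th having `L i` vertices, the center joined to vertex `0` of each leg. -/
def spider {k : ℕ} (L : Fin k → ℕ) : SimpleGraph (Option (Σ i : Fin k, Fin (L i))) :=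
  SimpleGraph.fromRel (fun x y =>
    (∃ (i : Fin k) (j : Fin (L i)), x = none ∧ y = some ⟨i, j⟩ ∧ (j : ℕ) = 0) ∨
    (∃ (i : Fin k) (j j' : Fin (L i)),
      x = some ⟨i, j⟩ ∧ y = some ⟨i, j'⟩ ∧ (j' : ℕ) = (j : ℕ) + 1))

/-- Leg lengths of the balanced starlike tree `BS n k`: the legs sum to `n - 1` and
pairwise differ by at most `1`. -/
def balancedLegs (n k : ℕ) : Fin k → ℕ :=
  fun i => (n - 1) / k + if (i : ℕ) < (n - 1) % k then 1 else 0

/-- The balanced starlike tree `BS_{n,k}` on `n` vertices with `k` legs of almost equal length. -/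
def BS (n k : ℕ) : SimpleGraph (Option (Σ i : Fin k, Fin (balancedLegs n k i))) :=
  spider (balancedLegs n k)

/-- Leg lengths of the broom `B_{n,k}`: one leg with `n - k` vertices, `k - 1` legs with one. -/
def broomLegs (n k : ℕ) : Fin k → ℕ := fun i => if (i : ℕ) = 0 then n - k else 1

/-- The broom `B_{n,k} = S(n-k, 1, …, 1)`. -/
def broom (n k : ℕ) : SimpleGraph (Option (Σ i : Fin k, Fin (broomLegs n k i))) :=
  spider (broomLegs n k)

/-- Leg lengths of the spur `A_{n,m}`: `n - m - 1` legs with two vertices, the rest with one. -/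
def spurLegs (n m : ℕ) : Fin m → ℕ := fun i => if (i : ℕ) < n - m - 1 then 2 else 1

/-- The spur `A_{n,m}`: the star `S_{m+1}` with a pendent edge attached to `n - m - 1`
of its pendent vertices. -/
def spur (n m : ℕ) : SimpleGraph (Option (Σ i : Fin m, Fin (spurLegs n m i))) :=
  spider (spurLegs n m)

/-- The caterpillar `C_{n,d,i}`: a path `v_0 v_1 … v_d` with `n - d - 1` pendent
vertices attached at `v_i`. -/
def caterpillar (n d i : ℕ) : SimpleGraph (Fin (d + 1) ⊕ Fin (n - d - 1)) :=
  SimpleGraph.fromRel (fun x y =>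
    (∃ a b : Fin (d + 1), x = Sum.inl a ∧ y = Sum.inl b ∧ (b : ℕ) = (a : ℕ) + 1) ∨
    (∃ (a : Fin (d + 1)) (p : Fin (n - d - 1)), (a : ℕ) = i ∧ x = Sum.inl a ∧ y = Sum.inr p))

/-- Degree of a vertex. -/
noncomputable def deg {V : Type*} [Fintype V] (G : SimpleGraph V) (v : V) : ℕ :=
  (G.neighborSet v).ncard

/-- Eccentricity of a vertex: the maximum distance to another vertex. -/
noncomputable def ecc {V : Type*} [Fintype V] (G : SimpleGraph V) (v : V) : ℕ :=
  Finset.univ.sup fun u => G.dist v u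

/-- Diameter of a graph: the maximum eccentricity. -/
noncomputable def graphDiam {V : Type*} [Fintype V] (G : SimpleGraph V) : ℕ :=
  Finset.univ.sup fun v => ecc G v

/-- Radius of a graph: the minimum eccentricity. -/
noncomputable def graphRadius {V : Type*} [Fintype V] (G : SimpleGraph V) : ℕ :=
  sInf (Set.range fun v => ecc G v)

/-- Matching number: the maximum cardinality of a set of pairwise non-incident edges. -/
noncomputable def matchingNumber {V : Type*} [Fintype V] (G : SimpleGraph V) : ℕ :=
  sSup {k | ∃ M : Finset (Sym2 V), M.card = k ∧ (∀ e ∈ M, e ∈ G.edgeSet) ∧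
    ∀ e ∈ M, ∀ f ∈ M, e ≠ f → ∀ v : V, ¬(v ∈ e ∧ v ∈ f)}

/-- Independence number: the maximum cardinality of a set of pairwise non-adjacent vertices. -/
noncomputable def indepNum {V : Type*} [Fintype V] (G : SimpleGraph V) : ℕ :=
  sSup {k | ∃ s : Finset V, s.card = k ∧ ∀ u ∈ s, ∀ v ∈ s, u ≠ v → ¬ G.Adj u v}


namespace SimpleGraph

variable {V W : Type*} {G : SimpleGraph V} {H : SimpleGraph W}

lemma Iso.dist_le (e : G ≃g H) (hG : G.Connected) (u v : V) :
    H.dist (e u) (e v) ≤ G.dist u v := by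
  obtain ⟨p, hp⟩ := hG.exists_walk_length_eq_dist u v
  rw [← hp]
  simpa using SimpleGraph.dist_le (p.map e.toHom)

lemma Iso.dist_eq (e : G ≃g H) (hG : G.Connected) (u v : V) :
    H.dist (e u) (e v) = G.dist u v := by
  refine le_antisymm (e.dist_le hG u v) ?_
  simpa using e.symm.dist_le (e.connected_iff.1 hG) (e u) (e v)

/-- In a tree, a vertex has at most one neighbour that is closer to a given root. -/
lemma IsTree.eq_of_adj_of_dist (hG : G.IsTree) {r x y z : V} (hy : G.Adj y x) (hz : G.Adj z x)
    (hdy : G.dist r x = G.dist r y + 1) (hdz : G.dist r x = G.dist r z + 1) : y = z := by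
  obtain ⟨p, hp⟩ := hG.connected.exists_walk_length_eq_dist r y
  obtain ⟨q, hq⟩ := hG.connected.exists_walk_length_eq_dist r z
  have hp' : (p.concat hy).IsPath :=
    Walk.isPath_of_length_eq_dist _ (by rw [Walk.length_concat, hp, hdy])
  have hq' : (q.concat hz).IsPath :=
    Walk.isPath_of_length_eq_dist _ (by rw [Walk.length_concat, hq, hdz])
  have h := congrArg (fun w : G.Path r x => w.1.penultimate)
    ((hG.isAcyclic.subsingleton_path r x).elim ⟨_, hp'⟩ ⟨_, hq'⟩)
  simpa using h

/-- Along a geodesic of a tree, the distance to a fixed vertex is V-shaped. -/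
lemma IsTree.exists_dist_eq_add (hG : G.IsTree) {d : ℕ} {v : ℕ → V}
    (hv : ∀ i ≤ d, ∀ j ≤ d, G.dist (v i) (v j) = (i - j) + (j - i)) (u : V) :
    ∃ p ≤ d, ∀ j ≤ d, G.dist u (v j) = G.dist u (v p) + ((p - j) + (j - p)) := by
  have hadj : ∀ j < d, G.Adj (v j) (v (j + 1)) := fun j hj => by
    rw [← dist_eq_one_iff_adj, hv _ (by omega) _ (by omega)]; omega
  have hstep := fun j hj => hG.dist_eq_dist_add_one_of_adj u (hadj j hj)
  have hup : ∀ j, j + 1 < d → G.dist u (v (j + 1)) = G.dist u (v j) + 1 →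
      G.dist u (v (j + 2)) = G.dist u (v (j + 1)) + 1 := by
    intro j hj h
    rcases hstep (j + 1) hj with h' | h'
    · have := hG.eq_of_adj_of_dist (hadj j (by omega)) (hadj (j + 1) hj).symm h h'
      have h0 := hv j (by omega) (j + 2) (by omega)
      rw [this, dist_self] at h0
      omega
    · exact h'
  have hprefix : ∀ k ≤ d, ∃ p ≤ k, ∀ j ≤ k,
      G.dist u (v j) = G.dist u (v p) + ((p - j) + (j - p)) := by
    intro k
    induction k with
    | zero =>
      refine fun _ => ⟨0, le_rfl, fun j hj => ?_⟩
      obtain rfl : j = 0 := by omega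
      simp
    | succ k ih =>
      intro hk
      obtain ⟨p, hpk, hp⟩ := ih (by omega)
      rcases hstep k (by omega) with h | h
      · have hpk' : p = k := by
          by_contra hne
          obtain ⟨t, rfl⟩ : ∃ t, k = t + 1 := ⟨k - 1, by omega⟩
          have h1 := hp t (by omega)
          have h2 := hp (t + 1) le_rfl
          have h3 := hup t (by omega) (by omega)
          have h4 : G.dist u (v (t + 1 + 1)) = G.dist u (v (t + 2)) := rfl
          omega
        subst hpk'
        refine ⟨p + 1, le_rfl, fun j hj => ?_⟩
        rcases Nat.lt_or_ge p j with hj' | hj'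
        · obtain rfl : j = p + 1 := by omega
          simp
        · have := hp j hj'
          omega
      · refine ⟨p, by omega, fun j hj => ?_⟩
        rcases Nat.lt_or_ge k j with hj' | hj'
        · obtain rfl : j = k + 1 := by omega
          have := hp k le_rfl
          omega
        · exact hp j hj'
  exact hprefix d le_rfl

lemma Connected.exists_geodesic (hG : G.Connected) (x y : V) :
    ∃ v : ℕ → V, ∀ i ≤ G.dist x y, ∀ j ≤ G.dist x y,
      G.dist (v i) (v j) = (i - j) + (j - i) := by
  obtain ⟨w, hw⟩ := hG.exists_walk_length_eq_dist x y
  have hstep : ∀ i k, i + k ≤ w.length → G.dist (w.getVert i) (w.getVert (i + k)) ≤ k := by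
    intro i k
    induction k with
    | zero => simp
    | succ k ih =>
      intro hk
      have h1 := ih (by omega)
      have h2 := dist_eq_one_iff_adj.2 (w.adj_getVert_succ (i := i + k) (by omega))
      have h3 := hG.dist_triangle (u := w.getVert i) (v := w.getVert (i + k))
        (w := w.getVert (i + k + 1))
      rw [← add_assoc]
      omega
  have hle : ∀ i k, i + k ≤ w.length → G.dist (w.getVert i) (w.getVert (i + k)) = k := by
    intro i k hik
    have h1 := hstep 0 i (by omega)
    have h2 := hstep i k hik
    have h3 := hstep (i + k) (w.length - (i + k)) (by omega)
    rw [Nat.add_sub_cancel' hik, Walk.getVert_length] at h3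
    rw [zero_add, Walk.getVert_zero] at h1
    have h4 := hG.dist_triangle (u := x) (v := w.getVert i) (w := w.getVert (i + k))
    have h5 := hG.dist_triangle (u := x) (v := w.getVert (i + k)) (w := y)
    omega
  refine ⟨w.getVert, fun i hi j hj => ?_⟩
  rcases le_total i j with h | h
  · obtain ⟨k, rfl⟩ := Nat.exists_eq_add_of_le h
    rw [hle i k (by omega)]; omega
  · obtain ⟨k, rfl⟩ := Nat.exists_eq_add_of_le h
    rw [dist_comm, hle j k (by omega)]; omega

lemma Walk.one_div_length_le {u v : V} (w : G.Walk u v) (huv : u ≠ v) :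
    (1 : ℝ) / w.length ≤ 1 / G.dist u v := by
  have h : 0 < G.dist u v := w.reachable.pos_dist_of_ne huv
  exact one_div_le_one_div_of_le (by exact_mod_cast h) (by exact_mod_cast SimpleGraph.dist_le w)

lemma exists_dist_eq_graphDiam [Fintype V] [Nonempty V] (G : SimpleGraph V) :
    ∃ x y, G.dist x y = graphDiam G := by
  obtain ⟨x, -, hx⟩ := Finset.exists_mem_eq_sup univ univ_nonempty fun v => ecc G v
  obtain ⟨y, -, hy⟩ := Finset.exists_mem_eq_sup univ univ_nonempty fun u => G.dist x u
  exact ⟨x, y, by rw [graphDiam, hx, ecc, hy]⟩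

end SimpleGraph

/-- The sum of the reciprocal distances from a vertex to the vertices of a path of length `d`,
when the vertex lies at depth `h` below the `p`-th vertex of the path. -/
noncomputable def pathTransmission (d h p : ℕ) : ℝ :=
  ∑ j ∈ range (d + 1), (1 : ℝ) / ((h + ((p - j) + (j - p)) : ℕ) : ℝ)

lemma pathTransmission_add_half_lt {d h p : ℕ} (hd : 1 ≤ d) (hp : p ≤ d) (hh : 2 ≤ h) :
    pathTransmission d h p + 1 / 2 < pathTransmission d 1 p := by
  have hhalf : (1 / 2 : ℝ) = ∑ j ∈ range (d + 1), if j = p then 1 / 2 else 0 := by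
    rw [Finset.sum_ite_eq', if_pos (mem_range.2 (by omega))]
  have hlt : ∀ j, (1 : ℝ) / ((h + ((p - j) + (j - p)) : ℕ) : ℝ) <
      1 / ((1 + ((p - j) + (j - p)) : ℕ) : ℝ) := fun j =>
    one_div_lt_one_div_of_lt (by exact_mod_cast (by omega)) (by exact_mod_cast (by omega))
  rw [hhalf, pathTransmission, pathTransmission, ← sum_add_distrib]
  obtain ⟨q, hq, hqp⟩ : ∃ q ≤ d, q ≠ p := by
    rcases eq_or_ne p 0 with rfl | h0
    · exact ⟨1, hd, one_ne_zero⟩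
    · exact ⟨0, Nat.zero_le d, h0.symm⟩
  refine sum_lt_sum (fun j _ => ?_) ⟨q, mem_range.2 (by omega), ?_⟩
  · split_ifs with hj
    · subst hj
      have : (1 : ℝ) / h ≤ 1 / 2 := one_div_le_one_div_of_le two_pos (by exact_mod_cast hh)
      norm_num at this ⊢
      linarith
    · simpa using (hlt j).le
  · rw [if_neg hqp, add_zero]
    exact hlt _

lemma pathTransmission_succ (d p : ℕ) (hp : p ≤ d) :
    pathTransmission d 1 (p + 1) =
      pathTransmission d 1 p + 1 / ((p : ℝ) + 2) - 1 / ((d : ℝ) - p + 1) := by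
  rw [pathTransmission, pathTransmission, sum_range_succ', sum_range_succ]
  simp only [Nat.add_sub_add_right]
  have h1 : ((1 + ((p + 1 - 0) + (0 - (p + 1))) : ℕ) : ℝ) = p + 2 := by push_cast; simp; ring
  have h2 : ((1 + ((p - d) + (d - p)) : ℕ) : ℝ) = d - p + 1 := by
    rw [Nat.sub_eq_zero_of_le hp]; push_cast [hp]; ring
  rw [h1, h2]
  ring

lemma pathTransmission_symm (d h p : ℕ) (hp : p ≤ d) :
    pathTransmission d h (d - p) = pathTransmission d h p := by
  rw [pathTransmission, ← sum_range_reflect]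
  refine sum_congr rfl fun j hj => ?_
  rw [mem_range] at hj
  congr 2
  omega

lemma pathTransmission_lt_of_lt_half {d q : ℕ} (hq : q ≤ d / 2) {p : ℕ} (hp : p < q) :
    pathTransmission d 1 p < pathTransmission d 1 q := by
  induction q with
  | zero => omega
  | succ q ih =>
    have hstep : pathTransmission d 1 q < pathTransmission d 1 (q + 1) := by
      rw [pathTransmission_succ d q (by omega)]
      have hqd : 2 * (q : ℝ) + 2 ≤ d := by exact_mod_cast (by omega : 2 * q + 2 ≤ d)
      have := one_div_lt_one_div_of_lt (a := (q : ℝ) + 2) (b := (d : ℝ) - q + 1)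
        (by positivity) (by linarith)
      linarith
    rcases Nat.lt_succ_iff_lt_or_eq.1 hp with h | rfl
    · exact (ih (by omega) h).trans hstep
    · exact hstep

lemma pathTransmission_lt_half {d p : ℕ} (hp : p ≤ d) (h1 : p ≠ d / 2) (h2 : p ≠ d - d / 2) :
    pathTransmission d 1 p < pathTransmission d 1 (d / 2) := by
  rcases Nat.lt_or_ge p (d / 2) with h | h
  · exact pathTransmission_lt_of_lt_half le_rfl h
  · rw [← pathTransmission_symm d 1 p hp]
    exact pathTransmission_lt_of_lt_half le_rfl (by omega)

lemma pathTransmission_le_half {d p : ℕ} (hp : p ≤ d) :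
    pathTransmission d 1 p ≤ pathTransmission d 1 (d / 2) := by
  by_cases h1 : p = d / 2
  · rw [h1]
  by_cases h2 : p = d - d / 2
  · rw [h2, pathTransmission_symm _ _ _ (by omega)]
  exact (pathTransmission_lt_half hp h1 h2).le

lemma two_mul_harary_eq {V α β : Type*} [Fintype V] [Fintype α] [Fintype β]
    [DecidableEq α] [DecidableEq β] (G : SimpleGraph V) (e : α ⊕ β ≃ V) :
    2 * harary G =
      (∑ a : α, ∑ b : α, if a = b then 0 else (1 : ℝ) / G.dist (e (.inl a)) (e (.inl b))) +
      2 * (∑ k : β, ∑ a : α, (1 : ℝ) / G.dist (e (.inr k)) (e (.inl a))) +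
      ∑ k : β, ∑ l : β, if k = l then 0 else (1 : ℝ) / G.dist (e (.inr k)) (e (.inr l)) := by
  have hsum : ∀ f : V → ℝ, ∑ u, f u = ∑ x : α ⊕ β, f (e x) := fun f => (e.sum_comp f).symm
  have hcomm : (∑ a : α, ∑ k : β, (1 : ℝ) / G.dist (e (.inl a)) (e (.inr k))) =
      ∑ k : β, ∑ a : α, (1 : ℝ) / G.dist (e (.inr k)) (e (.inl a)) := by
    rw [sum_comm]
    simp only [G.dist_comm]
  rw [harary, hsum]
  simp only [hsum, Fintype.sum_sum_type, EmbeddingLike.apply_eq_iff_eq, Sum.inl.injEq,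
    Sum.inr.injEq, reduceCtorEq, if_false, sum_add_distrib, hcomm]
  ring

lemma harary_eq_of_iso {V W : Type*} [Fintype V] [Fintype W] {G : SimpleGraph V}
    {H : SimpleGraph W} (hG : G.Connected) (e : G ≃g H) : harary G = harary H := by
  classical
  rw [harary, harary, ← e.toEquiv.sum_comp]
  congr 1
  refine sum_congr rfl fun u _ => ?_
  rw [← e.toEquiv.sum_comp]
  refine sum_congr rfl fun v _ => ?_
  have h : H.dist (e.toEquiv u) (e.toEquiv v) = G.dist u v := e.dist_eq hG u v
  simp only [h, EmbeddingLike.apply_eq_iff_eq]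

/-- Twice the Harary index of a caterpillar with spine of length `d` and `m` pendent vertices
attached to the middle of the spine. -/
noncomputable def twiceCaterpillarHarary (d m : ℕ) : ℝ :=
  (∑ a : Fin (d + 1), ∑ b : Fin (d + 1),
    if a = b then 0 else (1 : ℝ) / (((a : ℕ) - b + (b - a) : ℕ) : ℝ)) +
  2 * (∑ _k : Fin m, pathTransmission d 1 (d / 2)) +
  ∑ k : Fin m, ∑ l : Fin m, if k = l then 0 else (1 / 2 : ℝ)

section caterpillar

variable {n d i : ℕ}

lemma caterpillar_adj_inl_inl (a b : Fin (d + 1)) :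
    (caterpillar n d i).Adj (.inl a) (.inl b) ↔ (a : ℕ) - b + (b - a) = 1 := by
  simp only [caterpillar, SimpleGraph.fromRel_adj, ne_eq, Sum.inl.injEq, reduceCtorEq, and_false,
    exists_false, or_false]
  constructor
  · rintro ⟨-, ⟨x, y, rfl, rfl, h⟩ | ⟨x, y, rfl, rfl, h⟩⟩ <;> omega
  · intro h
    refine ⟨by rintro rfl; omega, ?_⟩
    rcases Nat.lt_or_ge (a : ℕ) b with h' | h'
    · exact .inl ⟨a, b, rfl, rfl, by omega⟩
    · exact .inr ⟨b, a, rfl, rfl, by omega⟩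

lemma caterpillar_adj_inr_inl (k : Fin (n - d - 1)) (a : Fin (d + 1)) :
    (caterpillar n d i).Adj (.inr k) (.inl a) ↔ (a : ℕ) = i := by
  simp [caterpillar]

lemma not_caterpillar_adj_inr_inr (k l : Fin (n - d - 1)) :
    ¬ (caterpillar n d i).Adj (.inr k) (.inr l) := by
  simp [caterpillar]

lemma exists_walk_caterpillar_of_add (k : ℕ) (a b : Fin (d + 1)) (h : (a : ℕ) + k = b) :
    ∃ w : (caterpillar n d i).Walk (.inl a) (.inl b), w.length = k := by
  induction k generalizing a with
  | zero =>
    obtain rfl : a = b := Fin.ext (by omega)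
    exact ⟨.nil, rfl⟩
  | succ k ih =>
    obtain ⟨w, hw⟩ := ih ⟨a + 1, by omega⟩ (by simp; omega)
    exact ⟨.cons ((caterpillar_adj_inl_inl _ _).2 (by simp)) w, by simp [hw]⟩

lemma exists_walk_caterpillar (a b : Fin (d + 1)) :
    ∃ w : (caterpillar n d i).Walk (.inl a) (.inl b), w.length = (a : ℕ) - b + (b - a) := by
  rcases le_total (a : ℕ) b with h | h
  · obtain ⟨w, hw⟩ := exists_walk_caterpillar_of_add (n := n) (i := i) (b - a) a b (by omega)
    exact ⟨w, by omega⟩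
  · obtain ⟨w, hw⟩ := exists_walk_caterpillar_of_add (n := n) (i := i) (a - b) b a (by omega)
    exact ⟨w.reverse, by rw [SimpleGraph.Walk.length_reverse]; omega⟩

lemma twiceCaterpillarHarary_le :
    twiceCaterpillarHarary d (n - d - 1) ≤ 2 * harary (caterpillar n d (d / 2)) := by
  classical
  rw [two_mul_harary_eq _ (Equiv.refl _), twiceCaterpillarHarary]
  simp only [Equiv.refl_apply]
  gcongr with a _ b _ k _ k _ l
  · split_ifs with h
    · rfl
    · obtain ⟨w, hw⟩ := exists_walk_caterpillar (n := n) (i := d / 2) a b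
      rw [← hw]
      exact w.one_div_length_le (by simpa using h)
  · rw [pathTransmission, Finset.sum_range]
    refine sum_le_sum fun a _ => ?_
    obtain ⟨w, hw⟩ := exists_walk_caterpillar (n := n) (i := d / 2) ⟨d / 2, by omega⟩ a
    have hadj := (caterpillar_adj_inr_inl (i := d / 2) k ⟨d / 2, by omega⟩).2 rfl
    have := (SimpleGraph.Walk.cons hadj w).one_div_length_le (by simp)
    rwa [SimpleGraph.Walk.length_cons, hw, add_comm] at this
  · split_ifs with h
    · rfl
    · have h1 := (caterpillar_adj_inr_inl (i := d / 2) k ⟨d / 2, by omega⟩).2 rfl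
      have h2 := (caterpillar_adj_inr_inl (i := d / 2) l ⟨d / 2, by omega⟩).2 rfl
      simpa using (SimpleGraph.Walk.cons h1 (.cons h2.symm .nil)).one_div_length_le
        (by simpa using h)

lemma nonempty_iso_caterpillar {V : Type*} {T : SimpleGraph V}
    (e : Fin (d + 1) ⊕ Fin (n - d - 1) ≃ V)
    (hpath : ∀ a b, T.dist (e (.inl a)) (e (.inl b)) = (a : ℕ) - b + (b - a))
    (hleaf : ∀ k a, T.dist (e (.inr k)) (e (.inl a)) = 1 + (i - (a : ℕ) + (a - i)))
    (hindep : ∀ k l, ¬ T.Adj (e (.inr k)) (e (.inr l))) :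
    Nonempty (T ≃g caterpillar n d i) := by
  have hinr : ∀ k a, T.Adj (e (.inr k)) (e (.inl a)) ↔
      (caterpillar n d i).Adj (.inr k) (.inl a) := fun k a => by
    rw [← SimpleGraph.dist_eq_one_iff_adj, hleaf, caterpillar_adj_inr_inl]
    omega
  refine ⟨(RelIso.symm ⟨e, fun {x y} => ?_⟩)⟩
  rcases x with a | k <;> rcases y with b | l
  · rw [← SimpleGraph.dist_eq_one_iff_adj, hpath, caterpillar_adj_inl_inl]
  · rw [T.adj_comm, SimpleGraph.adj_comm (caterpillar n d i)]
    exact hinr l a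
  · exact hinr k b
  · exact iff_of_false (hindep k l) (not_caterpillar_adj_inr_inr k l)

end caterpillar

lemma sum_add_sum_offDiag_le {ι : Type*} [Fintype ι] [DecidableEq ι] {x : ι → ℝ}
    {c D : ι → ι → ℝ} {F : ℝ} (hdiag : ∀ k, c k k = 0)
    (hx : ∀ k, 2 * x k + ∑ l, c k l ≤ 2 * F)
    (hD : ∀ k l, k ≠ l → D k l ≤ 1 / 2 + c k l / 2 + c l k / 2) :
    2 * (∑ k, x k) + (∑ k, ∑ l, if k = l then 0 else D k l) ≤
        2 * (∑ _k : ι, F) + ∑ k : ι, ∑ l : ι, (if k = l then 0 else (1 / 2 : ℝ)) ∧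
      (2 * (∑ k, x k) + (∑ k, ∑ l, if k = l then 0 else D k l) =
          2 * (∑ _k : ι, F) + ∑ k : ι, ∑ l : ι, (if k = l then 0 else (1 / 2 : ℝ)) →
        (∀ k, 2 * x k + ∑ l, c k l = 2 * F) ∧
          ∀ k l, k ≠ l → D k l = 1 / 2 + c k l / 2 + c l k / 2) := by
  have hnonneg1 : ∀ k, 0 ≤ 2 * F - (2 * x k + ∑ l, c k l) := fun k => sub_nonneg.2 (hx k)
  have hnonneg2 : ∀ k l, 0 ≤ (if k = l then 0 else 1 / 2 + c k l / 2 + c l k / 2) -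
      if k = l then 0 else D k l := fun k l => by
    split_ifs with h
    · simp
    · exact sub_nonneg.2 (hD k l h)
  have hsplit : ∀ k l, (if k = l then 0 else 1 / 2 + c k l / 2 + c l k / 2) =
      (if k = l then 0 else 1 / 2) + c k l / 2 + c l k / 2 := fun k l => by
    split_ifs with h
    · subst h; simp [hdiag]
    · rfl
  have hcc : ∑ k, ∑ l, c l k = ∑ k, ∑ l, c k l := sum_comm
  have hid : (∑ k, (2 * F - (2 * x k + ∑ l, c k l))) +
      (∑ k, ∑ l, ((if k = l then 0 else 1 / 2 + c k l / 2 + c l k / 2) -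
        if k = l then 0 else D k l)) =
      (2 * (∑ _k : ι, F) + ∑ k : ι, ∑ l : ι, (if k = l then 0 else (1 / 2 : ℝ))) -
      (2 * (∑ k, x k) + (∑ k, ∑ l, if k = l then 0 else D k l)) := by
    simp only [hsplit, sum_sub_distrib, sum_add_distrib, ← sum_div, ← mul_sum, hcc]
    ring
  have hs1 := sum_nonneg fun k (_ : k ∈ univ) => hnonneg1 k
  have hs2 := sum_nonneg fun k (_ : k ∈ univ) => sum_nonneg fun l (_ : l ∈ univ) => hnonneg2 k l
  refine ⟨by linarith, fun heq => ⟨fun k => ?_, fun k l hkl => ?_⟩⟩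
  · have h0 := (sum_eq_zero_iff_of_nonneg fun k _ => hnonneg1 k).1
      (le_antisymm (by linarith) hs1) k (mem_univ k)
    linarith
  · have h0 := (sum_eq_zero_iff_of_nonneg fun k _ => sum_nonneg fun l _ => hnonneg2 k l).1
      (le_antisymm (by linarith) hs2) k (mem_univ k)
    have h1 := (sum_eq_zero_iff_of_nonneg fun l _ => hnonneg2 k l).1 h0 l (mem_univ l)
    rw [if_neg hkl, if_neg hkl] at h1
    linarith

/-- The Harary index of a tree with a labelled geodesic of length `d` is at most that of the caterpillar,
and in the equality case all vertices off the path hang from one common middle vertex. -/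
lemma two_mul_harary_le {V : Type*} [Fintype V] {T : SimpleGraph V} (hT : T.IsTree) {d m : ℕ}
    (hd : 1 ≤ d) (e : Fin (d + 1) ⊕ Fin m ≃ V)
    (hpath : ∀ a b, T.dist (e (.inl a)) (e (.inl b)) = (a : ℕ) - b + (b - a)) :
    2 * harary T ≤ twiceCaterpillarHarary d m ∧
      (2 * harary T = twiceCaterpillarHarary d m →
        ∃ p, (p = d / 2 ∨ p = d - d / 2) ∧
          (∀ k a, T.dist (e (.inr k)) (e (.inl a)) = 1 + (p - (a : ℕ) + (a - p))) ∧
          ∀ k l, ¬ T.Adj (e (.inr k)) (e (.inr l))) := by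
  classical
  have hbranch : ∀ k : Fin m, ∃ h p : ℕ, 1 ≤ h ∧ p ≤ d ∧
      ∀ a : Fin (d + 1), T.dist (e (.inr k)) (e (.inl a)) = h + (p - (a : ℕ) + (a - p)) := by
    intro k
    obtain ⟨p, hp, hdist⟩ := hT.exists_dist_eq_add (d := d)
      (v := fun j => e (.inl (Fin.ofNat (d + 1) j)))
      (fun i hi j hj => by
        rw [hpath]
        simp [Nat.mod_eq_of_lt (Nat.lt_succ_of_le hi), Nat.mod_eq_of_lt (Nat.lt_succ_of_le hj)])
      (e (.inr k))
    refine ⟨_, p, hT.connected.pos_dist_of_ne (u := e (.inr k))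
      (v := e (.inl (Fin.ofNat (d + 1) p))) (e.injective.ne Sum.inr_ne_inl), hp, fun a => ?_⟩
    simpa using hdist a (by omega)
  choose h p hh hp hdist using hbranch
  let r := e (.inl 0)
  let parent : Fin m → Fin m → Prop := fun k l =>
    T.Adj (e (.inr k)) (e (.inr l)) ∧ T.dist r (e (.inr k)) = T.dist r (e (.inr l)) + 1
  have hparent_adj : ∀ k l, T.Adj (e (.inr k)) (e (.inr l)) → parent k l ∨ parent l k :=
    fun k l hadj => (hT.dist_eq_dist_add_one_of_adj r hadj).imp (⟨hadj, ·⟩) (⟨hadj.symm, ·⟩)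
  have hparent_unique : ∀ k l l', parent k l → parent k l' → l = l' := fun k l l' h1 h2 => by
    simpa using hT.eq_of_adj_of_dist h1.1.symm h2.1.symm h1.2 h2.2
  have hparent_depth : ∀ k l, parent k l → 2 ≤ h k := by
    intro k l hkl
    by_contra hk
    have hk1 : h k = 1 := by have := hh k; omega
    have hpd := hp k
    have hadj : T.Adj (e (.inl ⟨p k, by omega⟩)) (e (.inr k)) := by
      rw [T.adj_comm, ← SimpleGraph.dist_eq_one_iff_adj, hdist, hk1]; simp
    have hr : T.dist r (e (.inr k)) = T.dist r (e (.inl ⟨p k, by omega⟩)) + 1 := by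
      rw [T.dist_comm, hdist, hpath, hk1]; simp; omega
    simpa using hT.eq_of_adj_of_dist hadj hkl.1.symm hr hkl.2
  let c : Fin m → Fin m → ℝ := fun k l => if parent k l then 1 else 0
  have hc : ∀ k, ∑ l, c k l ≤ if 2 ≤ h k then 1 else 0 := by
    intro k
    by_cases hk : ∃ l, parent k l
    · obtain ⟨l, hl⟩ := hk
      rw [if_pos (hparent_depth k l hl), sum_eq_single l]
      · simp [c, hl]
      · intro l' _ hne
        exact if_neg fun hl' => hne (hparent_unique k _ _ hl' hl)
      · simp
    · rw [sum_eq_zero fun l _ => if_neg fun hl => hk ⟨l, hl⟩]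
      positivity
  have hdeep : ∀ k, 2 ≤ h k → 2 * pathTransmission d (h k) (p k) + ∑ l, c k l <
      2 * pathTransmission d 1 (d / 2) := by
    intro k hk
    have h1 := hc k
    rw [if_pos hk] at h1
    have h2 := pathTransmission_add_half_lt hd (hp k) hk
    have h3 := pathTransmission_le_half (hp k)
    linarith
  have hshallow : ∀ k, ¬ 2 ≤ h k → h k = 1 ∧ ∑ l, c k l = 0 := fun k hk =>
    ⟨by have := hh k; omega, sum_eq_zero fun l _ => if_neg fun hl => hk (hparent_depth k l hl)⟩
  have hx : ∀ k, 2 * pathTransmission d (h k) (p k) + ∑ l, c k l ≤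
      2 * pathTransmission d 1 (d / 2) := by
    intro k
    by_cases hk : 2 ≤ h k
    · exact (hdeep k hk).le
    · obtain ⟨h1, h2⟩ := hshallow k hk
      rw [h1, h2]
      linarith [pathTransmission_le_half (hp k)]
  have hc0 : ∀ k l, 0 ≤ c k l := fun k l => by
    simp only [c]; split_ifs <;> norm_num
  have hD : ∀ k l, k ≠ l → (1 : ℝ) / T.dist (e (.inr k)) (e (.inr l)) ≤
      1 / 2 + c k l / 2 + c l k / 2 := by
    intro k l hkl
    by_cases hadj : T.Adj (e (.inr k)) (e (.inr l))
    · rw [SimpleGraph.dist_eq_one_iff_adj.2 hadj]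
      have h1 := hc0 k l
      have h2 := hc0 l k
      rcases hparent_adj k l hadj with h3 | h3
      · have : c k l = 1 := if_pos h3
        push_cast; linarith
      · have : c l k = 1 := if_pos h3
        push_cast; linarith
    · have h2 := hT.connected.one_lt_dist_of_ne_of_not_adj
        (u := e (.inr k)) (v := e (.inr l)) (by simpa using hkl) hadj
      have h3 : (1 : ℝ) / T.dist (e (.inr k)) (e (.inr l)) ≤ 1 / 2 :=
        one_div_le_one_div_of_le two_pos (by exact_mod_cast h2)
      linarith [hc0 k l, hc0 l k]
  have hcdiag : ∀ k, c k k = 0 := fun k => if_neg fun hk => T.loopless.irrefl _ hk.1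
  have hsumpath : ∀ k : Fin m, ∑ a : Fin (d + 1), (1 : ℝ) / T.dist (e (.inr k)) (e (.inl a)) =
      pathTransmission d (h k) (p k) := fun k => by
    simp only [hdist, pathTransmission, Finset.sum_range]
  obtain ⟨hle, heq⟩ := sum_add_sum_offDiag_le hcdiag hx hD
  rw [two_mul_harary_eq T e, twiceCaterpillarHarary]
  simp only [hpath, hsumpath]
  refine ⟨by linarith, fun hE => ?_⟩
  obtain ⟨hall, hpairs⟩ := heq (by linarith)
  have hh1 : ∀ k, h k = 1 := fun k => by
    by_contra hk
    have h2 : 2 ≤ h k := by have := hh k; omega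
    exact (hdeep k h2).ne (hall k)
  have hnp : ∀ k l, ¬ parent k l := fun k l hkl => by
    have := hparent_depth k l hkl
    rw [hh1] at this
    omega
  have hindep : ∀ k l, ¬ T.Adj (e (.inr k)) (e (.inr l)) := fun k l hadj =>
    (hparent_adj k l hadj).elim (hnp _ _) (hnp _ _)
  have hmid : ∀ k, p k = d / 2 ∨ p k = d - d / 2 := fun k => by
    by_contra! hk
    have h1 := pathTransmission_lt_half (hp k) hk.1 hk.2
    have h2 := hall k
    rw [(hshallow k (by rw [hh1]; omega)).2, hh1] at h2
    linarith
  have hconst : ∀ k l, p k = p l := by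
    intro k l
    by_cases hkl : k = l
    · rw [hkl]
    have h2 := hpairs k l hkl
    have hckl : ∀ k l, c k l = 0 := fun k l => if_neg (hnp k l)
    rw [hckl, hckl] at h2
    have h3 : T.dist (e (.inr k)) (e (.inr l)) = 2 := by
      have : (T.dist (e (.inr k)) (e (.inr l)) : ℝ) = 2 := by
        rw [← one_div_one_div (T.dist (e (.inr k)) (e (.inr l)) : ℝ), h2]
        norm_num
      exact_mod_cast this
    obtain ⟨w, hw⟩ := hT.connected.exists_walk_length_eq_dist (e (.inr k)) (e (.inr l))
    rw [h3] at hw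
    have ha1 := w.adj_getVert_succ (i := 0) (by omega)
    have ha2 := w.adj_getVert_succ (i := 1) (by omega)
    have hend : w.getVert (1 + 1) = e (.inr l) := by
      rw [show 1 + 1 = w.length by omega, SimpleGraph.Walk.getVert_length]
    rw [SimpleGraph.Walk.getVert_zero, zero_add] at ha1
    rw [hend] at ha2
    obtain ⟨y, hy⟩ := e.surjective (w.getVert 1)
    rw [← hy] at ha1 ha2
    rcases y with a | q
    · rw [← SimpleGraph.dist_eq_one_iff_adj, hdist, hh1] at ha1
      rw [T.adj_comm, ← SimpleGraph.dist_eq_one_iff_adj, hdist, hh1] at ha2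
      omega
    · exact (hindep _ _ ha1).elim
  rcases isEmpty_or_nonempty (Fin m) with hm | ⟨⟨k₀⟩⟩
  · exact ⟨d / 2, .inl rfl, fun k => hm.elim k, hindep⟩
  · refine ⟨p k₀, hmid k₀, fun k a => ?_, hindep⟩
    rw [hdist, hh1, hconst k k₀]

lemma exists_equiv_sum_of_injective {α V : Type*} [Fintype α] [Fintype V] {f : α → V}
    (hf : Function.Injective f) {m : ℕ} (hm : Fintype.card V = Fintype.card α + m) :
    ∃ e : α ⊕ Fin m ≃ V, ∀ a, e (.inl a) = f a := by
  classical
  have hcard : Fintype.card {x // x ∉ Set.range f} = m := by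
    have h1 := Fintype.card_compl_set (Set.range f)
    rw [Set.card_range_of_injective hf] at h1
    have h2 : Fintype.card {x // x ∉ Set.range f} = Fintype.card ((Set.range f)ᶜ : Set V) :=
      Fintype.card_congr (Equiv.refl _)
    omega
  let g := (Fintype.equivFinOfCardEq hcard).symm
  exact ⟨((Equiv.ofInjective f hf).sumCongr g).trans (Equiv.sumCompl (· ∈ Set.range f)),
    fun a => by simp⟩

theorem harary_diameter_max {V : Type*} [Fintype V] (T : SimpleGraph V) (hT : T.IsTree)
    (n d : ℕ) (hd2 : 2 ≤ d) (hdn : d ≤ n - 1) (hcard : Fintype.card V = n)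
    (hdiam : graphDiam T = d) :
    harary T ≤ harary (caterpillar n d (d / 2)) ∧
    (harary T = harary (caterpillar n d (d / 2)) ↔
      Nonempty (T ≃g caterpillar n d (d / 2))) := by
  have : Nonempty V := hT.connected.nonempty
  obtain ⟨x, y, hxy⟩ := T.exists_dist_eq_graphDiam
  obtain ⟨v, hv⟩ := hT.connected.exists_geodesic x y
  rw [hxy, hdiam] at hv
  have hinj : Function.Injective fun a : Fin (d + 1) => v a := fun a b hab => by
    have h := hv a (by omega) b (by omega)
    rw [show v a = v b from hab, SimpleGraph.dist_self] at h
    exact Fin.ext (by omega)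
  obtain ⟨e, he⟩ := exists_equiv_sum_of_injective hinj (m := n - d - 1)
    (by rw [hcard, Fintype.card_fin]; omega)
  have hpath : ∀ a b, T.dist (e (.inl a)) (e (.inl b)) = (a : ℕ) - b + (b - a) := fun a b => by
    rw [he, he, hv _ (by omega) _ (by omega)]
  obtain ⟨hle, heq⟩ := two_mul_harary_le hT (by omega) e hpath
  have hcat := twiceCaterpillarHarary_le (n := n) (d := d)
  refine ⟨by linarith, fun hE => ?_, fun ⟨φ⟩ => harary_eq_of_iso hT.connected φ⟩
  obtain ⟨p, rfl | rfl, hleaf, hindep⟩ := heq (by linarith)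
  · exact nonempty_iso_caterpillar e hpath hleaf hindep
  · refine nonempty_iso_caterpillar ((Fin.revPerm.sumCongr (Equiv.refl _)).trans e)
      (fun a b => ?_) (fun k a => ?_) (fun k l => ?_)
    · simp [hpath]; omega
    · simp [hleaf]; omega
    · simpa using hindep k l
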